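/- arXiv:1110.2058 — 6 statements merged into one kernel-verified Lean document; each statement's English description precedes it below -/
import Mathlib

section
/- Assume in addition that a and b are twice continuously differentiable and that φ(v)·a'(v) + b'(v) = 0 for all v ∈ ℝ. Then for any t, u ∈ ℝ, KL(π(t,·), π(u,·)) = ∫_A π(t,y)·log( π(t,y)/π(u,y) ) dλ(y) ≤ (1/2)·( sup_{v ∈ [min(t,u), max(t,u)]} | φ(t)·a''(v) + b''(v) | )·(t − u)². -/
open MeasureTheory Real

/-- Second-order Taylor expansion at a critical point, with Lagrange remainder. -/
lemma exists_sub_eq_deriv_deriv_mul_sq {g : ℝ → ℝ} (hg : ContDiff ℝ 2 g) {t u : ℝ}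
    (htu : t ≠ u) (hgt : deriv g t = 0) :
    ∃ v ∈ Set.uIcc t u, g u - g t = 1 / 2 * deriv (deriv g) v * (u - t) ^ 2 := by
  obtain ⟨v, hv, h⟩ := taylor_mean_remainder_lagrange_iteratedDeriv (n := 1) htu
    (hg.contDiffOn.of_le (by norm_num))
  have hd : derivWithin g (Set.uIcc t u) t = 0 := by
    rw [((hg.differentiable (by norm_num)) t).derivWithin
      (uniqueDiffOn_uIcc htu t Set.left_mem_uIcc), hgt]
  refine ⟨v, Set.uIoo_subset_uIcc_self hv, ?_⟩
  rw [taylorWithinEval_succ, taylor_within_zero_eval, iteratedDerivWithin_one, hd,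
    iteratedDeriv_succ, iteratedDeriv_one] at h
  norm_num at h
  linarith

/-- The Kullback-Leibler divergence between two members of a one-parameter exponential family
is affine in the natural parameters, with the mean as slope. -/
lemma integral_exp_mul_log_exp_div_exp {lam : Measure ℝ} {c : ℝ → ℝ} {p q r s : ℝ}
    (hint : Integrable (fun y => Real.exp (y * p + q + c y)) lam)
    (hmean : Integrable (fun y => y * Real.exp (y * p + q + c y)) lam) :
    ∫ y, Real.exp (y * p + q + c y) *
        Real.log (Real.exp (y * p + q + c y) / Real.exp (y * r + s + c y)) ∂lam
      = (∫ y, y * Real.exp (y * p + q + c y) ∂lam) * (p - r)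
        + (∫ y, Real.exp (y * p + q + c y) ∂lam) * (q - s) := by
  rw [← integral_mul_const, ← integral_mul_const,
    ← integral_add (hmean.mul_const _) (hint.mul_const _)]
  congr 1 with y
  rw [← Real.exp_sub, Real.log_exp]
  ring

/-- In a one-parameter exponential family `π(t,y) = exp(y·a(t) + b(t) + c(y))` with
mean `φ` satisfying `φ(v)a'(v) + b'(v) = 0`, the Kullback-Leibler divergence between
parameters `t` and `u` is bounded by
`(1/2)·(sup_{v ∈ [min t u, max t u]} |φ(t)a''(v) + b''(v)|)·(t − u)²`. -/
theorem kl_exponential_family_le (lam : Measure ℝ) (a b c : ℝ → ℝ)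
    (ha : ContDiff ℝ 2 a) (hb : ContDiff ℝ 2 b) (hc : Measurable c)
    (hint : ∀ t : ℝ, Integrable (fun y => Real.exp (y * a t + b t + c y)) lam)
    (hnorm : ∀ t : ℝ, ∫ y, Real.exp (y * a t + b t + c y) ∂lam = 1)
    (hmean : ∀ t : ℝ, Integrable (fun y => y * Real.exp (y * a t + b t + c y)) lam)
    (φ : ℝ → ℝ)
    (hφ : ∀ t : ℝ, φ t = ∫ y, y * Real.exp (y * a t + b t + c y) ∂lam)
    (hid : ∀ v : ℝ, φ v * deriv a v + deriv b v = 0)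
    (t u : ℝ) :
    ∫ y, Real.exp (y * a t + b t + c y) *
        Real.log (Real.exp (y * a t + b t + c y) / Real.exp (y * a u + b u + c y)) ∂lam
      ≤ (1 / 2) * (sSup {z : ℝ | ∃ v ∈ Set.Icc (min t u) (max t u),
          z = |φ t * deriv (deriv a) v + deriv (deriv b) v|}) * (t - u) ^ 2 := by
  rw [integral_exp_mul_log_exp_div_exp (hint t) (hmean t), ← hφ, hnorm]
  rcases eq_or_ne t u with rfl | htu
  · simp
  have ha' : Differentiable ℝ a := ha.differentiable (by norm_num)
  have hb' : Differentiable ℝ b := hb.differentiable (by norm_num)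
  have ha1 : ContDiff ℝ 1 (deriv a) := ContDiff.deriv' ha
  have hb1 : ContDiff ℝ 1 (deriv b) := ContDiff.deriv' hb
  have hg' : deriv (fun v => φ t * a v + b v) = fun v => φ t * deriv a v + deriv b v := by
    ext v
    exact (((ha' v).hasDerivAt.const_mul _).add (hb' v).hasDerivAt).deriv
  have hg'' : deriv (fun v => φ t * deriv a v + deriv b v)
      = fun v => φ t * deriv (deriv a) v + deriv (deriv b) v := by
    ext v
    exact (((ha1.differentiable (by norm_num) v).hasDerivAt.const_mul _).add
      (hb1.differentiable (by norm_num) v).hasDerivAt).deriv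
  obtain ⟨v, hv, h⟩ := exists_sub_eq_deriv_deriv_mul_sq (g := fun v => φ t * a v + b v)
    ((contDiff_const.mul ha).add hb) htu (by rw [hg']; exact hid t)
  rw [hg', hg''] at h
  have hcont : Continuous fun v => |φ t * deriv (deriv a) v + deriv (deriv b) v| :=
    ((continuous_const.mul (ha1.continuous_deriv le_rfl)).add
      (hb1.continuous_deriv le_rfl)).abs
  have hbdd : BddAbove {z : ℝ | ∃ v ∈ Set.Icc (min t u) (max t u),
      z = |φ t * deriv (deriv a) v + deriv (deriv b) v|} := by
    refine (isCompact_Icc.bddAbove_image hcont.continuousOn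
      (K := Set.Icc (min t u) (max t u))).mono ?_
    rintro z ⟨w, hw, rfl⟩
    exact ⟨w, hw, rfl⟩
  have hle := le_csSup hbdd ⟨v, hv, rfl⟩
  have hneg := (neg_le_abs _).trans hle
  have hsq := mul_le_mul_of_nonneg_right hneg (sq_nonneg (t - u))
  have hsymm : (u - t) ^ 2 = (t - u) ^ 2 := by ring
  rw [hsymm] at h
  linarith
end

section
/- For every x ∈ Ω and y ∈ A, the log-likelihood ratio of the true density to the mixture-of-experts density satisfies log( p(x,y) / f(x,y) ) ≤ ( |y|·ȧ∞ + ḃ∞ )·Σ_{j=1}^m g_j(x)·| h(x) − h_j(x) |, where ȧ∞ = sup_{|t| ≤ H} |a'(t)| and ḃ∞ = sup_{|t| ≤ H} |b'(t)|. -/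
open MeasureTheory Real

/-- A `C¹` function on `[-H, H]` is Lipschitz with constant the supremum of `|φ'|`. -/
lemma abs_sub_le_sSup_abs_deriv_mul {φ : ℝ → ℝ} (hφ : ContDiff ℝ 1 φ) {H s t : ℝ}
    (hs : |s| ≤ H) (ht : |t| ≤ H) :
    |φ s - φ t| ≤ sSup ((fun u => |deriv φ u|) '' Set.Icc (-H) H) * |s - t| := by
  have hbdd : BddAbove ((fun u => |deriv φ u|) '' Set.Icc (-H) H) :=
    (isCompact_Icc.image (hφ.continuous_deriv le_rfl).abs).bddAbove
  exact Convex.norm_image_sub_le_of_norm_deriv_le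
    (fun u _ => (hφ.differentiable one_ne_zero).differentiableAt)
    (fun u hu => le_csSup hbdd (Set.mem_image_of_mem _ hu))
    (convex_Icc (-H) H) (abs_le.mp ht) (abs_le.mp hs)

/-- Jensen's inequality for the log-ratio of `exp z` to a finite mixture of exponentials. -/
lemma log_exp_div_sum_mul_exp_le {ι : Type*} [Fintype ι] {w : ι → ℝ}
    (hw : ∀ j, 0 ≤ w j) (hsum : ∑ j, w j = 1) (z : ℝ) (v : ι → ℝ) :
    Real.log (Real.exp z / ∑ j, w j * Real.exp (v j)) ≤ ∑ j, w j * (z - v j) := by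
  have hjensen : Real.exp (∑ j, w j * v j) ≤ ∑ j, w j * Real.exp (v j) := by
    simpa only [smul_eq_mul] using
      convexOn_exp.map_sum_le (fun j _ => hw j) hsum (fun j _ => Set.mem_univ (v j))
  have hpos := (Real.exp_pos _).trans_le hjensen
  rw [Real.log_div (Real.exp_ne_zero z) hpos.ne', Real.log_exp]
  have hlog := (Real.le_log_iff_exp_le hpos).mpr hjensen
  simp only [mul_sub, Finset.sum_sub_distrib, ← Finset.sum_mul, hsum, one_mul]
  linarith

/-- Pointwise bound on the log-likelihood ratio of the true exponential-family density
to a mixture-of-experts density: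
`log(p(x,y)/f(x,y)) ≤ (|y|·ȧ∞ + ḃ∞)·Σ_j g_j(x)·|h(x) − h_j(x)|`, where
`ȧ∞ = sup_{|t|≤H} |a'(t)|` and `ḃ∞ = sup_{|t|≤H} |b'(t)|`. -/
theorem log_likelihood_ratio_le (lam : Measure ℝ) (a b c : ℝ → ℝ)
    (ha : ContDiff ℝ 1 a) (hb : ContDiff ℝ 1 b) (hc : Measurable c)
    (hnorm : ∀ t : ℝ, ∫ y, Real.exp (y * a t + b t + c y) ∂lam = 1)
    {Ω : Type*} (H : ℝ) (hH : 0 < H)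
    (m : ℕ) (h : Ω → ℝ) (he : Fin m → Ω → ℝ)
    (hhb : ∀ x, |h x| ≤ H) (hheb : ∀ j x, |he j x| ≤ H)
    (g : Fin m → Ω → ℝ)
    (hg01 : ∀ j x, g j x ∈ Set.Icc (0 : ℝ) 1)
    (hgsum : ∀ x, ∑ j, g j x = 1)
    (p f : Ω → ℝ → ℝ)
    (hp : ∀ x y, p x y = Real.exp (y * a (h x) + b (h x) + c y))
    (hf : ∀ x y, f x y = ∑ j, g j x * Real.exp (y * a (he j x) + b (he j x) + c y))
    (aInf bInf : ℝ)
    (haInf : aInf = sSup ((fun t => |deriv a t|) '' Set.Icc (-H) H))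
    (hbInf : bInf = sSup ((fun t => |deriv b t|) '' Set.Icc (-H) H)) :
    ∀ (x : Ω) (y : ℝ),
      Real.log (p x y / f x y)
        ≤ (|y| * aInf + bInf) * ∑ j, g j x * |h x - he j x| := by
  intro x y
  rw [hp, hf]
  refine (log_exp_div_sum_mul_exp_le (fun j => (hg01 j x).1) (hgsum x) _ _).trans ?_
  rw [Finset.mul_sum]
  refine Finset.sum_le_sum fun j _ => ?_
  rw [mul_left_comm]
  refine mul_le_mul_of_nonneg_left ?_ (hg01 j x).1
  have hA : |a (h x) - a (he j x)| ≤ aInf * |h x - he j x| :=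
    haInf ▸ abs_sub_le_sSup_abs_deriv_mul ha (hhb x) (hheb j x)
  have hB : |b (h x) - b (he j x)| ≤ bInf * |h x - he j x| :=
    hbInf ▸ abs_sub_le_sSup_abs_deriv_mul hb (hhb x) (hheb j x)
  calc y * a (h x) + b (h x) + c y - (y * a (he j x) + b (he j x) + c y)
      = y * (a (h x) - a (he j x)) + (b (h x) - b (he j x)) := by ring
    _ ≤ |y| * |a (h x) - a (he j x)| + |b (h x) - b (he j x)| :=
        add_le_add ((le_abs_self _).trans_eq (abs_mul _ _)) (le_abs_self _)
    _ ≤ |y| * (aInf * |h x - he j x|) + bInf * |h x - he j x| := by gcongr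
    _ = (|y| * aInf + bInf) * |h x - he j x| := by ring
end

section
/- For any real numbers u, v, w ≥ 0, ( √((u+w)/2) − √((v+w)/2) )² ≤ (1/2)·( √u − √v )². -/
/-- Pointwise inequality underlying the √2-contraction of the Hellinger distance under
averaging with a common density: for `u, v, w ≥ 0`,
`(√((u+w)/2) − √((v+w)/2))² ≤ (1/2) * (√u − √v)²`. -/
theorem sq_sqrt_avg_le (u v w : ℝ) (hu : 0 ≤ u) (hv : 0 ≤ v) (hw : 0 ≤ w) :
    (Real.sqrt ((u + w) / 2) - Real.sqrt ((v + w) / 2)) ^ 2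
      ≤ (1 / 2) * (Real.sqrt u - Real.sqrt v) ^ 2 := by
  have hA : √((u + w) / 2) ^ 2 = (u + w) / 2 := Real.sq_sqrt (by positivity)
  have hB : √((v + w) / 2) ^ 2 = (v + w) / 2 := Real.sq_sqrt (by positivity)
  have ha : √u ^ 2 = u := Real.sq_sqrt hu
  have hb : √v ^ 2 = v := Real.sq_sqrt hv
  have cauchy : w + √u * √v ≤ 2 * (√((u + w) / 2) * √((v + w) / 2)) := by
    refine (abs_le_of_sq_le_sq' ?_ (by positivity)).2
    calc (w + √u * √v) ^ 2 ≤ (√u ^ 2 + w) * (√v ^ 2 + w) := by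
          nlinarith [mul_nonneg hw (sq_nonneg (√u - √v))]
      _ = (2 * (√((u + w) / 2) * √((v + w) / 2))) ^ 2 := by
          rw [mul_pow, mul_pow, hA, hB, ha, hb]
          ring
  linarith [sub_sq (√((u + w) / 2)) (√((v + w) / 2)), sub_sq (√u) (√v)]
end

section
/- Let (S, λ) be a measure space and f₁, f₂, f* : S → [0,∞) measurable functions. Then √2 · d_h( (f₁+f*)/2, (f₂+f*)/2 ) ≤ d_h( f₁, f₂ ), where for nonnegative measurable p, q the Hellinger distance is d_h(p,q) = ( (1/2)·∫_S ( √p − √q )² dλ )^{1/2}. Equivalently, ∫_S ( √((f₁+f*)/2) − √((f₂+f*)/2) )² dλ ≤ (1/2)·∫_S ( √f₁ − √f₂ )² dλ. -/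
open MeasureTheory Real

/-- Pointwise form of the contraction: averaging with a common value `c` halves the squared
difference of square roots. -/
theorem sq_sqrt_avg_sub_sqrt_avg_le {a b c : ℝ} (ha : 0 ≤ a) (hb : 0 ≤ b) (hc : 0 ≤ c) :
    (√((a + c) / 2) - √((b + c) / 2)) ^ 2 ≤ 1 / 2 * (√a - √b) ^ 2 := by
  have hP : √((a + c) / 2) ^ 2 = (a + c) / 2 := sq_sqrt (by positivity)
  have hQ : √((b + c) / 2) ^ 2 = (b + c) / 2 := sq_sqrt (by positivity)
  have hA : √a ^ 2 = a := sq_sqrt ha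
  have hB : √b ^ 2 = b := sq_sqrt hb
  have hcross : (√a * √b + c) / 2 ≤ √((a + c) / 2) * √((b + c) / 2) := by
    refine (pow_le_pow_iff_left₀ (by positivity) (by positivity) two_ne_zero).1 ?_
    rw [mul_pow, hP, hQ]
    have hAB : (√a * √b) ^ 2 = a * b := by rw [mul_pow, hA, hB]
    nlinarith [mul_nonneg hc (sq_nonneg (√a - √b))]
  nlinarith

/-- Averaging two densities with a common density `f*` contracts the Hellinger
distance by a factor `√2`:
`√2 · d_h((f₁+f*)/2, (f₂+f*)/2) ≤ d_h(f₁, f₂)`, where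
`d_h(p,q) = ((1/2)·∫ (√p − √q)² dλ)^{1/2}`. -/
theorem hellinger_avg_contraction {S : Type*} [MeasurableSpace S] (lam : Measure S)
    (f₁ f₂ fs : S → ℝ)
    (hf₁ : Measurable f₁) (hf₂ : Measurable f₂) (hfs : Measurable fs)
    (hf₁0 : ∀ x, 0 ≤ f₁ x) (hf₂0 : ∀ x, 0 ≤ f₂ x) (hfs0 : ∀ x, 0 ≤ fs x)
    (hint : Integrable (fun x => (Real.sqrt (f₁ x) - Real.sqrt (f₂ x)) ^ 2) lam) :
    Real.sqrt 2 * Real.sqrt ((1 / 2) *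
        ∫ x, (Real.sqrt ((f₁ x + fs x) / 2) - Real.sqrt ((f₂ x + fs x) / 2)) ^ 2 ∂lam)
      ≤ Real.sqrt ((1 / 2) * ∫ x, (Real.sqrt (f₁ x) - Real.sqrt (f₂ x)) ^ 2 ∂lam) := by
  rw [← Real.sqrt_mul zero_le_two]
  apply Real.sqrt_le_sqrt
  rw [← mul_assoc, mul_one_div_cancel two_ne_zero, one_mul, ← integral_const_mul]
  exact integral_mono_of_nonneg (.of_forall fun _ => sq_nonneg _) (hint.const_mul _)
    (.of_forall fun x => sq_sqrt_avg_sub_sqrt_avg_le (hf₁0 x) (hf₂0 x) (hfs0 x))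
end

section
/- For every real x ≥ 0, ∫_x^∞ √t · e^{−t} dt ≤ ( √π + √x )·e^{−x}. -/
open MeasureTheory Real

theorem integrableOn_sqrt_mul_exp_neg :
    IntegrableOn (fun t : ℝ => √t * Real.exp (-t)) (Set.Ioi 0) := by
  refine (Real.GammaIntegral_convergent (s := 3 / 2) (by norm_num)).congr_fun ?_ measurableSet_Ioi
  intro t _
  simp only [Real.sqrt_eq_rpow]
  norm_num [mul_comm]

theorem integral_sqrt_mul_exp_neg :
    ∫ t in Set.Ioi (0 : ℝ), √t * Real.exp (-t) = √π / 2 := by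
  have h : Real.Gamma (1 / 2 + 1) = √π / 2 := by
    rw [Real.Gamma_add_one (by norm_num), Real.Gamma_one_half_eq]
    ring
  rw [← h, Real.Gamma_eq_integral (by norm_num)]
  congr with t
  rw [Real.sqrt_eq_rpow, mul_comm]
  norm_num

/-- Bound on the upper incomplete gamma function `Γ(3/2, x)`:
for `x ≥ 0`, `∫_x^∞ √t e^{−t} dt ≤ (√π + √x) e^{−x}`. -/
theorem incomplete_gamma_three_halves_le (x : ℝ) (hx : 0 ≤ x) :
    ∫ t in Set.Ioi x, Real.sqrt t * Real.exp (-t)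
      ≤ (Real.sqrt π + Real.sqrt x) * Real.exp (-x) := by
  have hshift : ∫ t in Set.Ioi x, √t * Real.exp (-t)
      = ∫ u in Set.Ioi (0 : ℝ), √(u + x) * Real.exp (-(u + x)) := by
    rw [← (measurePreserving_add_right volume x).setIntegral_preimage_emb
      (measurableEmbedding_addRight x), Set.preimage_add_const_Ioi, sub_self]
  have hsplit : IntegrableOn (fun u : ℝ => √u * Real.exp (-u) + √x * Real.exp (-u))
      (Set.Ioi 0) :=
    integrableOn_sqrt_mul_exp_neg.add ((integrableOn_exp_neg_Ioi 0).const_mul _)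
  calc ∫ t in Set.Ioi x, √t * Real.exp (-t)
      = ∫ u in Set.Ioi (0 : ℝ), √(u + x) * Real.exp (-(u + x)) := hshift
    _ ≤ ∫ u in Set.Ioi (0 : ℝ),
          (√u * Real.exp (-u) + √x * Real.exp (-u)) * Real.exp (-x) := by
        refine integral_mono_of_nonneg (ae_of_all _ fun u => by positivity)
          (hsplit.mul_const _) ((ae_restrict_iff' measurableSet_Ioi).2 (ae_of_all _ ?_))
        intro u hu
        have hu' : 0 ≤ u := le_of_lt hu
        have hsqrt : √(u + x) ≤ √u + √x := by
          rw [Real.sqrt_le_left (by positivity)]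
          nlinarith [Real.sq_sqrt hu', Real.sq_sqrt hx,
            mul_nonneg (Real.sqrt_nonneg u) (Real.sqrt_nonneg x)]
        calc √(u + x) * Real.exp (-(u + x))
            ≤ (√u + √x) * Real.exp (-(u + x)) := by gcongr
          _ = (√u * Real.exp (-u) + √x * Real.exp (-u)) * Real.exp (-x) := by
              rw [neg_add, Real.exp_add]
              ring
    _ = (√π / 2 + √x) * Real.exp (-x) := by
        rw [integral_mul_const, integral_add integrableOn_sqrt_mul_exp_neg
          ((integrableOn_exp_neg_Ioi 0).const_mul _), integral_const_mul,
          integral_sqrt_mul_exp_neg, integral_exp_neg_Ioi_zero, mul_one]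
    _ ≤ (√π + √x) * Real.exp (-x) := by
        gcongr
        exact half_le_self (Real.sqrt_nonneg π)
end

section
/- The function U(ξ) = C/n + ( C·ξ^{−s} )^{−2·min(ξ,α)/s}, defined for ξ ∈ (0, C^{1/s}], attains its minimum over (0, C^{1/s}] at ξ₀ = min( α, C^{1/s}/e ); that is, U(ξ₀) ≤ U(ξ) for all ξ ∈ (0, C^{1/s}]. -/
open Real

/-- The rate written as an exponential, with `log C / s = log (C^{1/s})`. -/
lemma rate_eq_exp {s C ξ : ℝ} (hs : 0 < s) (hC : 0 < C) (hξ : 0 < ξ) (b : ℝ) :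
    (C * ξ ^ (-s)) ^ (-(2 * b) / s) = exp (-(2 * (b * (log C / s - log ξ)))) := by
  rw [rpow_def_of_pos (by positivity), log_mul hC.ne' (by positivity), log_rpow hξ]
  congr 1
  field_simp
  ring

lemma mul_sub_log_le {x y : ℝ} (hx : 0 < x) (hy : 0 < y) :
    x * (log y - log x) ≤ y - x := by
  rw [← log_div hy.ne' hx.ne']
  calc x * log (y / x) ≤ x * (y / x - 1) := by
        gcongr
        exact log_le_sub_one_of_pos (by positivity)
    _ = y - x := by field_simp

/-- `x ↦ min x α * (L - log x)` is maximal on `(0, e^L]` at `min α e^{L-1}`. -/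
lemma min_mul_sub_log_le {α L x : ℝ} (hα : 0 < α) (hx : 0 < x) (hxL : log x ≤ L) :
    min x α * (L - log x) ≤
      min (min α (exp (L - 1))) α * (L - log (min α (exp (L - 1)))) := by
  rw [min_eq_left (min_le_left α _)]
  rcases le_total α (exp (L - 1)) with h | h
  · rw [min_eq_left h]
    have hlog : log α ≤ L - 1 := (log_le_iff_le_exp hα).2 h
    rcases le_total x α with hxα | hαx
    · rw [min_eq_left hxα]
      nlinarith [mul_sub_log_le hx hα]
    · rw [min_eq_right hαx]
      gcongr
  · rw [min_eq_right h, log_exp]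
    have hmin : min x α * (L - log x) ≤ x * (L - log x) :=
      mul_le_mul_of_nonneg_right (min_le_left x α) (sub_nonneg.2 hxL)
    have := mul_sub_log_le hx (exp_pos (L - 1))
    rw [log_exp] at this
    linarith

/-- Optimal compromise between the number of experts and the expert complexity:
under the constraint `m·ξ^s = C`, the bound
`U(ξ) = C/n + (C·ξ^{−s})^{−2·min(ξ,α)/s}` is minimized over `ξ ∈ (0, C^{1/s}]`
at `ξ₀ = min(α, C^{1/s}/e)`. -/
theorem U_min_at_xi0 (s : ℕ) (hs : 1 ≤ s) (α n C : ℝ) (hα : 0 < α) (hn : 0 < n)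
    (hC : Real.exp 1 ^ s < C)
    (U : ℝ → ℝ)
    (hU : ∀ ξ : ℝ, U ξ = C / n + (C * ξ ^ (-(s : ℝ))) ^ (-(2 * min ξ α) / (s : ℝ)))
    (ξ₀ : ℝ) (hξ₀ : ξ₀ = min α (C ^ ((1 : ℝ) / (s : ℝ)) / Real.exp 1)) :
    ∀ ξ ∈ Set.Ioc (0 : ℝ) (C ^ ((1 : ℝ) / (s : ℝ))), U ξ₀ ≤ U ξ := by
  rintro ξ ⟨hξ, hξC⟩
  have hs' : (0 : ℝ) < s := by exact_mod_cast hs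
  have hC' : 0 < C := lt_trans (by positivity) hC
  have hroot : C ^ ((1 : ℝ) / (s : ℝ)) = exp (log C / s) := by
    rw [rpow_def_of_pos hC', mul_one_div]
  rw [hroot, ← exp_sub] at hξ₀
  rw [hroot] at hξC
  have hξ₀pos : 0 < ξ₀ := hξ₀ ▸ lt_min hα (exp_pos _)
  have hmax := min_mul_sub_log_le hα hξ ((log_le_iff_le_exp hξ).2 hξC)
  rw [← hξ₀] at hmax
  rw [hU, hU, rate_eq_exp hs' hC' hξ₀pos, rate_eq_exp hs' hC' hξ]
  gcongr
end
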